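/- arXiv:2411.10062 — 6 statements merged into one kernel-verified Lean document; each statement's English description precedes it below -/
import Mathlib

section
/- Let X be any set, g : X → ℤ, and let UB ∈ ℕ be such that −UB ≤ g(x) for every x ∈ X. Define π(x) := ∏_{j=0}^{UB} (g(x) + j). Then for every x ∈ X: if g(x) ≤ 0 then π(x) = 0, and if g(x) ≥ 1 then π(x) ≥ 1. In particular, π is a valid penalty function for the constraint g(x) ≤ 0. -/
/-- Generic PUBO penalty: for an integer-valued constraint function `g` bounded below by
`-UB`, the product `∏_{j=0}^{UB} (g x + j)` vanishes exactly when `g x ≤ 0` and is at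
least `1` whenever `g x ≥ 1`. -/
theorem stmt_3 {X : Type*} (g : X → ℤ) (UB : ℕ) (hUB : ∀ x, -(UB : ℤ) ≤ g x) :
    ∀ x : X,
      (g x ≤ 0 → ∏ j ∈ Finset.range (UB + 1), (g x + (j : ℤ)) = 0) ∧
      (1 ≤ g x → 1 ≤ ∏ j ∈ Finset.range (UB + 1), (g x + (j : ℤ))) := by
  intro x
  have hx := hUB x
  refine ⟨fun h => ?_, fun h => ?_⟩
  · exact Finset.prod_eq_zero (i := (-g x).toNat) (Finset.mem_range.mpr (by omega)) (by omega)
  · have hpos : 0 < ∏ j ∈ Finset.range (UB + 1), (g x + (j : ℤ)) :=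
      Finset.prod_pos fun j _ => by omega
    omega
end

section
/- Let n ∈ ℕ, let c ∈ ℕ with c ≥ 1, and let x ∈ ℝ^n be a binary vector (each x_i ∈ {0,1}). Define π^eq_c(x) := 1 + Σ_{k=c}^{n} (−1)^{k−c+1} · C(k,c) · e_k(x). Then π^eq_c(x) = 0 if Σ_{i=1}^n x_i = c, and π^eq_c(x) = 1 otherwise. Hence π^eq_c is a penalty function for the equality constraint Σ_{i=1}^n x_i = c taking only the values 0 and 1. -/
/-- The alternating orthogonality relation for binomial coefficients. -/
theorem sum_Icc_neg_one_pow_mul_choose_mul_choose (n c m : ℕ) (hm : m ≤ n) :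
    ∑ k ∈ Finset.Icc c n, (-1 : ℝ) ^ (k - c + 1) * (k.choose c : ℝ) * (m.choose k : ℝ) =
      if m = c then -1 else 0 := by
  rcases lt_or_ge m c with h | h
  · rw [if_neg h.ne]
    refine Finset.sum_eq_zero fun k hk => ?_
    rw [Nat.choose_eq_zero_of_lt (h.trans_le (Finset.mem_Icc.1 hk).1)]
    simp
  · have restrict : ∑ k ∈ Finset.Icc c n,
        (-1 : ℝ) ^ (k - c + 1) * (k.choose c : ℝ) * (m.choose k : ℝ) =
        ∑ k ∈ Finset.Ico c (m + 1),
          (-1 : ℝ) ^ (k - c + 1) * (k.choose c : ℝ) * (m.choose k : ℝ) := by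
      symm
      refine Finset.sum_subset (fun k hk => ?_) fun k hk hk' => ?_
      · simp only [Finset.mem_Ico, Finset.mem_Icc] at *
        omega
      · simp only [Finset.mem_Ico, Finset.mem_Icc] at *
        rw [Nat.choose_eq_zero_of_lt (by omega : m < k)]
        simp
    have alternating : ∑ j ∈ Finset.range (m - c + 1), (-1 : ℝ) ^ j * ((m - c).choose j : ℝ) =
        if m - c = 0 then 1 else 0 := by
      exact_mod_cast congrArg (Int.cast : ℤ → ℝ) (Int.alternating_sum_range_choose (n := m - c))
    have term (j : ℕ) :
        (-1 : ℝ) ^ (c + j - c + 1) * ((c + j).choose c : ℝ) * (m.choose (c + j) : ℝ) =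
          -(m.choose c : ℝ) * ((-1 : ℝ) ^ j * ((m - c).choose j : ℝ)) := by
      have key : (m.choose (c + j) : ℝ) * ((c + j).choose c : ℝ) =
          (m.choose c : ℝ) * ((m - c).choose j : ℝ) := by
        have := Nat.choose_mul (n := m) (Nat.le_add_right c j)
        rw [Nat.add_sub_cancel_left] at this
        exact_mod_cast this
      rw [Nat.add_sub_cancel_left, pow_succ]
      linear_combination (-(-1 : ℝ) ^ j) * key
    rw [restrict, Finset.sum_Ico_eq_sum_range, Nat.sub_add_comm h]
    simp_rw [term]
    rw [← Finset.mul_sum, alternating]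
    by_cases hmc : m = c
    · simp [hmc]
    · rw [if_neg (by omega), if_neg hmc, mul_zero]

/-- On a binary vector, the elementary symmetric polynomial of degree `k` counts the
`k`-subsets of the support. -/
theorem sum_powersetCard_prod_of_binary {ι : Type*} [Fintype ι] (x : ι → ℝ)
    (hx : ∀ i, x i = 0 ∨ x i = 1) (k : ℕ) :
    ∑ S ∈ Finset.univ.powersetCard k, ∏ i ∈ S, x i =
      ((Finset.univ.filter fun i => x i = 1).card.choose k : ℝ) := by
  rw [← Finset.card_powersetCard, Finset.card_eq_sum_ones, Nat.cast_sum]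
  symm
  refine (Finset.sum_congr rfl fun S hS => ?_).trans
    (Finset.sum_subset (Finset.powersetCard_mono (Finset.subset_univ _)) fun S hS hS' => ?_)
  · rw [Finset.prod_eq_one fun i hi =>
      (Finset.mem_filter.1 ((Finset.mem_powersetCard.1 hS).1 hi)).2, Nat.cast_one]
  · have hsub : ¬ S ⊆ Finset.univ.filter fun i => x i = 1 := fun h =>
      hS' (Finset.mem_powersetCard.2 ⟨h, (Finset.mem_powersetCard.1 hS).2⟩)
    obtain ⟨i, hi, hi'⟩ := Finset.not_subset.1 hsub
    exact Finset.prod_eq_zero hi ((hx i).resolve_right fun h => hi' (by simp [h]))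

theorem sum_eq_card_filter_of_binary {ι : Type*} [Fintype ι] (x : ι → ℝ)
    (hx : ∀ i, x i = 0 ∨ x i = 1) :
    ∑ i, x i = ((Finset.univ.filter fun i => x i = 1).card : ℝ) := by
  rw [← Finset.sum_boole]
  refine Finset.sum_congr rfl fun i _ => ?_
  rcases hx i with h | h <;> simp [h]


/-- Binary-valued penalty for the equality constraint `∑ x_i = c` (with `c ≥ 1`):
`π^eq_c(x) = 1 + ∑_{k=c}^n (-1)^{k-c+1} C(k,c) e_k(x)` equals `0` when the constraint
holds and `1` otherwise, on binary vectors. -/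
theorem stmt_4 (n c : ℕ) (hc : 1 ≤ c) (x : Fin n → ℝ)
    (hx : ∀ i, x i = 0 ∨ x i = 1) :
    ((∑ i, x i) = (c : ℝ) →
      1 + ∑ k ∈ Finset.Icc c n, (-1 : ℝ) ^ (k - c + 1) * (k.choose c : ℝ) *
        ∑ S ∈ Finset.univ.powersetCard k, ∏ i ∈ S, x i = 0) ∧
    ((∑ i, x i) ≠ (c : ℝ) →
      1 + ∑ k ∈ Finset.Icc c n, (-1 : ℝ) ^ (k - c + 1) * (k.choose c : ℝ) *
        ∑ S ∈ Finset.univ.powersetCard k, ∏ i ∈ S, x i = 1) := by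
  have hcard : (Finset.univ.filter fun i => x i = 1).card ≤ n :=
    (Finset.card_le_univ _).trans_eq (Fintype.card_fin n)
  simp_rw [sum_powersetCard_prod_of_binary x hx]
  rw [sum_Icc_neg_one_pow_mul_choose_mul_choose n c _ hcard, sum_eq_card_filter_of_binary x hx]
  refine ⟨fun h => ?_, fun h => ?_⟩
  · rw [if_pos (Nat.cast_injective h)]
    norm_num
  · rw [if_neg fun h' => h (congrArg Nat.cast h'), add_zero]
end

section
/- Let n ∈ ℕ, c ∈ ℕ, and let x ∈ ℝ^n be a binary vector (each x_i ∈ {0,1}). Define π^inf_c(x) := Σ_{k=c+1}^{n} (−1)^{k−c+1} · C(k−1,c) · e_k(x). Then π^inf_c(x) = 0 if Σ_{i=1}^n x_i ≤ c, and π^inf_c(x) = 1 otherwise. Hence π^inf_c is a penalty function for the inequality constraint Σ_{i=1}^n x_i ≤ c taking only the values 0 and 1. -/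
/-- The alternating sum of a nontrivial row of Pascal's triangle vanishes, for any range
covering the row. -/
lemma alternating_sum_range_choose_eq_zero {d N : ℕ} (hd : d ≠ 0) (hN : d < N) :
    ∑ j ∈ Finset.range N, (-1 : ℤ) ^ j * (d.choose j : ℤ) = 0 := by
  rw [← Int.alternating_sum_range_choose_of_ne hd]
  refine (Finset.sum_subset (Finset.range_mono hN) fun j _ hj => ?_).symm
  rw [Finset.mem_range, not_lt] at hj
  simp [Nat.choose_eq_zero_of_lt (show d < j by omega)]

lemma alternating_sum_choose_mul_choose_eq_one (c d N : ℕ) (hN : d < N) :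
    ∑ j ∈ Finset.range N,
      (-1 : ℤ) ^ j * ((j + c).choose c : ℤ) * ((c + d + 1).choose (j + c + 1) : ℤ) = 1 := by
  induction d with
  | zero =>
    rw [Finset.sum_eq_single_of_mem 0 (Finset.mem_range.2 hN)]
    · simp
    · intro j _ hj
      simp [Nat.choose_eq_zero_of_lt (show c + 1 < j + c + 1 by omega)]
  | succ d ih =>
    have hterm : ∀ j : ℕ,
        (-1 : ℤ) ^ j * ((j + c).choose c : ℤ) * ((c + (d + 1) + 1).choose (j + c + 1) : ℤ) =
          ((c + d + 1).choose c : ℤ) * ((-1 : ℤ) ^ j * ((d + 1).choose j : ℤ)) +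
          (-1 : ℤ) ^ j * ((j + c).choose c : ℤ) * ((c + d + 1).choose (j + c + 1) : ℤ) := by
      intro j
      have h := Nat.choose_mul (n := c + d + 1) (k := j + c) (s := c) (Nat.le_add_left c j)
      rw [show c + d + 1 - c = d + 1 by omega, Nat.add_sub_cancel] at h
      have h' : ((c + d + 1).choose (j + c) : ℤ) * ((j + c).choose c : ℤ) =
          ((c + d + 1).choose c : ℤ) * ((d + 1).choose j : ℤ) := mod_cast h
      rw [← add_assoc c d 1, Nat.choose_succ_succ']
      push_cast
      linear_combination (-1 : ℤ) ^ j * h'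
    simp_rw [hterm]
    rw [Finset.sum_add_distrib, ← Finset.mul_sum,
      alternating_sum_range_choose_eq_zero d.succ_ne_zero hN, ih (by omega)]
    simp

/-- On the indicator vector of `s`, the `k`-th elementary symmetric polynomial is the number of
`k`-subsets of `s`. -/
lemma sum_powersetCard_prod_indicator {ι R : Type*} [Fintype ι] [DecidableEq ι] [CommSemiring R]
    (s : Finset ι) (k : ℕ) :
    ∑ S ∈ Finset.univ.powersetCard k, ∏ i ∈ S, (if i ∈ s then (1 : R) else 0) =
      (s.card.choose k : R) := by
  simp_rw [Finset.prod_ite_zero, Finset.prod_const_one]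
  rw [Finset.sum_boole, ← Finset.card_powersetCard]
  congr 2
  ext S
  simp only [Finset.mem_filter, Finset.mem_powersetCard, Finset.subset_univ, true_and]
  exact and_comm

/-- Binary-valued penalty for the inequality constraint `∑ x_i ≤ c`:
`π^inf_c(x) = ∑_{k=c+1}^n (-1)^{k-c+1} C(k-1,c) e_k(x)` equals `0` when the constraint
holds and `1` otherwise, on binary vectors. -/
theorem stmt_6 (n c : ℕ) (x : Fin n → ℝ) (hx : ∀ i, x i = 0 ∨ x i = 1) :
    ((∑ i, x i) ≤ (c : ℝ) →
      (∑ k ∈ Finset.Icc (c + 1) n, (-1 : ℝ) ^ (k - c + 1) * ((k - 1).choose c : ℝ) *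
        ∑ S ∈ Finset.univ.powersetCard k, ∏ i ∈ S, x i) = 0) ∧
    (¬ (∑ i, x i) ≤ (c : ℝ) →
      (∑ k ∈ Finset.Icc (c + 1) n, (-1 : ℝ) ^ (k - c + 1) * ((k - 1).choose c : ℝ) *
        ∑ S ∈ Finset.univ.powersetCard k, ∏ i ∈ S, x i) = 1) := by
  classical
  obtain ⟨s, rfl⟩ : ∃ s : Finset (Fin n), x = fun i => if i ∈ s then (1 : ℝ) else 0 := by
    refine ⟨Finset.univ.filter fun i => x i = 1, funext fun i => ?_⟩
    rcases hx i with h | h <;> simp [h]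
  have hs : s.card ≤ n := by simpa using s.card_le_univ
  simp_rw [sum_powersetCard_prod_indicator]
  have hsum : ∑ i, (if i ∈ s then (1 : ℝ) else 0) = s.card := by simp
  rw [hsum, Nat.cast_le, not_le]
  refine ⟨fun h => Finset.sum_eq_zero fun k hk => ?_, fun h => ?_⟩
  · rw [Finset.mem_Icc] at hk
    simp [Nat.choose_eq_zero_of_lt (show s.card < k by omega)]
  · obtain ⟨d, hd⟩ := Nat.exists_eq_add_of_lt h
    have key := alternating_sum_choose_mul_choose_eq_one c d (n - c) (by omega)
    rw [← Finset.Ico_add_one_right_eq_Icc, Finset.sum_Ico_eq_sum_range, Nat.add_sub_add_right,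
      hd]
    refine Eq.trans ?_ ((congrArg (Int.cast : ℤ → ℝ) key).trans Int.cast_one)
    rw [Int.cast_sum]
    refine Finset.sum_congr rfl fun j _ => ?_
    rw [show c + 1 + j - c + 1 = j + 2 by omega, show c + 1 + j - 1 = j + c by omega,
      show c + 1 + j = j + c + 1 by omega, pow_add]
    push_cast
    ring
end

section
/- Let n ∈ ℕ and let y ∈ ℝ^n be a binary vector (each y_i ∈ {0,1}). Define penUni(y) := Σ_{k=2}^{n} (−1)^k · (k−1) · e_k(y). Then penUni(y) = 0 if Σ_{i=1}^n y_i ≤ 1, and penUni(y) = 1 otherwise. Hence penUni is a penalty function taking only values 0 and 1 for the constraint that at most one of the y_i equals 1. -/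
/-- The sum of `|S| ∏ i ∈ S, f i` over `S ⊆ insert a s`, in terms of sums over `S ⊆ s`. -/
theorem sum_powerset_insert_card_mul_prod {ι R : Type*} [DecidableEq ι] [CommRing R]
    (f : ι → R) {a : ι} {s : Finset ι} (ha : a ∉ s) :
    ∑ S ∈ (insert a s).powerset, (S.card : R) * ∏ i ∈ S, f i =
      (1 + f a) * ∑ S ∈ s.powerset, (S.card : R) * ∏ i ∈ S, f i +
        f a * ∑ S ∈ s.powerset, ∏ i ∈ S, f i := by
  have h : ∀ S ∈ s.powerset, ((insert a S).card : R) * ∏ i ∈ insert a S, f i =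
      f a * ((S.card : R) * ∏ i ∈ S, f i) + f a * ∏ i ∈ S, f i := by
    intro S hS
    have haS : a ∉ S := fun h => ha (Finset.mem_powerset.1 hS h)
    rw [Finset.card_insert_of_notMem haS, Finset.prod_insert haS]
    push_cast
    ring
  rw [Finset.sum_powerset_insert ha, Finset.sum_congr rfl h, Finset.sum_add_distrib,
    ← Finset.mul_sum, ← Finset.mul_sum]
  ring

/-- The alternating subset sums of a binary vector, with and without the weight `|S|`, according
to whether it has zero, one, or at least two entries equal to `1`. -/
theorem sum_powerset_prod_neg_of_binary {ι : Type*} [DecidableEq ι] (y : ι → ℝ)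
    (hy : ∀ i, y i = 0 ∨ y i = 1) (s : Finset ι) :
    (∑ i ∈ s, y i = 0 ∧ ∑ S ∈ s.powerset, ∏ i ∈ S, -y i = 1 ∧
        ∑ S ∈ s.powerset, (S.card : ℝ) * ∏ i ∈ S, -y i = 0) ∨
      (∑ i ∈ s, y i = 1 ∧ ∑ S ∈ s.powerset, ∏ i ∈ S, -y i = 0 ∧
        ∑ S ∈ s.powerset, (S.card : ℝ) * ∏ i ∈ S, -y i = -1) ∨
      (2 ≤ ∑ i ∈ s, y i ∧ ∑ S ∈ s.powerset, ∏ i ∈ S, -y i = 0 ∧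
        ∑ S ∈ s.powerset, (S.card : ℝ) * ∏ i ∈ S, -y i = 0) := by
  induction s using Finset.induction_on with
  | empty => simp
  | insert a s ha ih =>
    rw [sum_powerset_insert_card_mul_prod _ ha, ← Finset.prod_one_add, Finset.prod_insert ha,
      Finset.prod_one_add, Finset.sum_insert ha]
    rcases hy a with h | h <;> rcases ih with ⟨h₁, h₂, h₃⟩ | ⟨h₁, h₂, h₃⟩ | ⟨h₁, h₂, h₃⟩ <;>
      rw [h, h₂, h₃]
    · left; norm_num [h₁]
    · right; left; norm_num [h₁]
    · right; right; norm_num [h₁]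
    · right; left; norm_num [h₁]
    · right; right; norm_num [h₁]
    · right; right; norm_num; linarith

/-- The penalty polynomial as a difference of subset sums. -/
theorem sum_Icc_two_esymm_eq (n : ℕ) (y : Fin n → ℝ) :
    ∑ k ∈ Finset.Icc 2 n, (-1 : ℝ) ^ k * ((k - 1 : ℕ) : ℝ) *
        ∑ S ∈ Finset.univ.powersetCard k, ∏ i ∈ S, y i =
      1 + ∑ S ∈ (Finset.univ : Finset (Fin n)).powerset, (S.card : ℝ) * ∏ i ∈ S, -y i -
        ∑ S ∈ (Finset.univ : Finset (Fin n)).powerset, ∏ i ∈ S, -y i := by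
  have hsub : Finset.Icc 2 n ⊆ Finset.range (n + 1) := by
    intro k hk
    simp only [Finset.mem_Icc, Finset.mem_range] at hk ⊢
    omega
  have hfiber : ∀ k, (-1 : ℝ) ^ k * ((k - 1 : ℕ) : ℝ) *
      ∑ S ∈ (Finset.univ : Finset (Fin n)).powersetCard k, ∏ i ∈ S, y i =
      ∑ S ∈ (Finset.univ : Finset (Fin n)).powersetCard k,
        ((S.card - 1 : ℕ) : ℝ) * ∏ i ∈ S, -y i := by
    intro k
    rw [Finset.mul_sum]
    refine Finset.sum_congr rfl fun S hS => ?_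
    rw [Finset.prod_neg, (Finset.mem_powersetCard.1 hS).2]
    ring
  have hterm : ∀ S : Finset (Fin n), ((S.card - 1 : ℕ) : ℝ) * ∏ i ∈ S, -y i =
      (if S = ∅ then 1 else 0) + (S.card : ℝ) * ∏ i ∈ S, -y i - ∏ i ∈ S, -y i := by
    intro S
    rcases S.eq_empty_or_nonempty with rfl | hS
    · simp
    · rw [Nat.cast_sub hS.card_pos, if_neg hS.ne_empty]
      push_cast
      ring
  rw [Finset.sum_subset hsub]
  · have hcard : n + 1 = (Finset.univ : Finset (Fin n)).card + 1 := by simp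
    rw [Finset.sum_congr rfl fun k _ => hfiber k, hcard, ← Finset.sum_powerset,
      Finset.sum_congr rfl fun S _ => hterm S, Finset.sum_sub_distrib, Finset.sum_add_distrib]
    simp
  · intro k hk hk'
    have : k - 1 = 0 := by
      simp only [Finset.mem_Icc, Finset.mem_range] at hk hk'
      omega
    simp [this]

/-- The binary-valued PUBO penalty for the constraint (Uni) that at most one `y_i`
equals 1: `penUni(y) = ∑_{k=2}^n (-1)^k (k-1) e_k(y)` equals `0` when `∑ y_i ≤ 1` and
`1` otherwise, on binary vectors. -/
theorem stmt_11 (n : ℕ) (y : Fin n → ℝ) (hy : ∀ i, y i = 0 ∨ y i = 1) :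
    ((∑ i, y i) ≤ 1 →
      (∑ k ∈ Finset.Icc 2 n, (-1 : ℝ) ^ k * ((k - 1 : ℕ) : ℝ) *
        ∑ S ∈ Finset.univ.powersetCard k, ∏ i ∈ S, y i) = 0) ∧
    (¬ (∑ i, y i) ≤ 1 →
      (∑ k ∈ Finset.Icc 2 n, (-1 : ℝ) ^ k * ((k - 1 : ℕ) : ℝ) *
        ∑ S ∈ Finset.univ.powersetCard k, ∏ i ∈ S, y i) = 1) := by
  rw [sum_Icc_two_esymm_eq]
  rcases sum_powerset_prod_neg_of_binary y hy Finset.univ with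
    ⟨h₁, h₂, h₃⟩ | ⟨h₁, h₂, h₃⟩ | ⟨h₁, h₂, h₃⟩ <;> rw [h₂, h₃]
  · norm_num [h₁]
  · norm_num [h₁]
  · exact ⟨fun h => by linarith, fun _ => by norm_num⟩
end

section
/- Let n ∈ ℕ, let CMax ∈ ℕ, let x ∈ {0,1} be a binary scalar, and let y ∈ ℝ^n be a binary vector (each y_j ∈ {0,1}). Define pen_0(y) := Σ_{k=1}^{n} (−1)^{k+1} e_k(y) and pen_1(y) := Σ_{k=CMax+1}^{n} (−1)^{k−CMax+1} C(k−1,CMax) e_k(y), and penCapa(x,y) := (1−x)·pen_0(y) + x·pen_1(y). Then penCapa(x,y) = 0 if Σ_{j=1}^n y_j ≤ CMax·x, and penCapa(x,y) = 1 otherwise. Hence penCapa is a penalty function taking only values 0 and 1 for the capacity constraint Σ_j y_j ≤ CMax·x. -/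
open Finset in
/-- On a binary vector, the `k`-th elementary symmetric polynomial counts the `k`-subsets of the
support. -/
theorem sum_powersetCard_prod_binary {ι : Type*} [Fintype ι] [DecidableEq ι] (y : ι → ℝ)
    (hy : ∀ j, y j = 0 ∨ y j = 1) (k : ℕ) :
    ∑ S ∈ univ.powersetCard k, ∏ j ∈ S, y j = ((#{j | y j = 1}).choose k : ℝ) := by
  have hprod (S : Finset ι) : ∏ j ∈ S, y j = if S ⊆ ({j | y j = 1} : Finset ι) then 1 else 0 := by
    split_ifs with h
    · exact prod_eq_one fun j hj => by simpa using h hj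
    · obtain ⟨j, hj, hj1⟩ := not_subset.mp h
      exact prod_eq_zero hj ((hy j).resolve_right (by simpa using hj1))
  rw [← card_powersetCard, sum_congr rfl fun S _ => hprod S, sum_boole]
  congr 2
  ext S
  simp [mem_powersetCard, and_comm]

theorem sum_binary {ι : Type*} [Fintype ι] (y : ι → ℝ) (hy : ∀ j, y j = 0 ∨ y j = 1) :
    ∑ j, y j = (Finset.card {j | y j = 1} : ℝ) := by
  rw [← Finset.sum_boole]
  refine Finset.sum_congr rfl fun j _ => ?_
  rcases hy j with h | h <;> simp [h]

theorem alternating_sum_range_choose_of_lt {d N : ℕ} (h : d < N) :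
    ∑ i ∈ Finset.range N, (-1 : ℝ) ^ i * (d.choose i : ℝ) = if d = 0 then 1 else 0 := by
  have hsub : Finset.range (d + 1) ⊆ Finset.range N := Finset.range_subset_range.mpr h
  rw [← Finset.sum_subset hsub fun i _ hi => by
    rw [Nat.choose_eq_zero_of_lt (by simpa using hi)]; simp]
  exact_mod_cast Int.alternating_sum_range_choose (n := d)

/-- Binomial inversion: the matrices `C(m, j)` and `(-1) ^ (j - c) * C(j, c)` are inverse. -/
theorem sum_range_neg_one_pow_choose_mul_choose {m c N : ℕ} (h : m < c + N) :
    ∑ i ∈ Finset.range N, (-1 : ℝ) ^ i * ((c + i).choose c : ℝ) * (m.choose (c + i) : ℝ) =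
      if m = c then 1 else 0 := by
  rcases lt_or_ge m c with hm | hm
  · rw [if_neg hm.ne]
    exact Finset.sum_eq_zero fun i _ => by
      simp [Nat.choose_eq_zero_of_lt (by omega : m < c + i)]
  · obtain ⟨d, rfl⟩ := Nat.exists_eq_add_of_le hm
    have hterm (i : ℕ) : (-1 : ℝ) ^ i * ((c + i).choose c : ℝ) * ((c + d).choose (c + i) : ℝ) =
        ((c + d).choose c : ℝ) * ((-1 : ℝ) ^ i * (d.choose i : ℝ)) := by
      have := Nat.choose_mul (n := c + d) (k := c + i) (s := c) (by omega)
      simp only [Nat.add_sub_cancel_left] at this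
      have : ((c + d).choose (c + i) : ℝ) * ((c + i).choose c : ℝ) =
        ((c + d).choose c : ℝ) * (d.choose i : ℝ) := mod_cast this
      linear_combination (-1 : ℝ) ^ i * this
    rw [Finset.sum_congr rfl fun i _ => hterm i, ← Finset.mul_sum,
      alternating_sum_range_choose_of_lt (by omega)]
    by_cases hd : d = 0 <;> simp [hd]

theorem sum_range_neg_one_pow_choose_mul_choose_succ {m c N : ℕ} (h : m ≤ c + N) :
    ∑ i ∈ Finset.range N, (-1 : ℝ) ^ i * ((c + i).choose c : ℝ) * (m.choose (c + i + 1) : ℝ) =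
      if c < m then 1 else 0 := by
  induction m with
  | zero => simp
  | succ m ih =>
    simp only [Nat.choose_succ_succ' m, Nat.cast_add, mul_add, Finset.sum_add_distrib]
    rw [ih (by omega), sum_range_neg_one_pow_choose_mul_choose (by omega)]
    rcases lt_trichotomy m c with hm | hm | hm
    · simp [hm.ne, show ¬ c < m by omega, show ¬ c < m + 1 by omega]
    · simp [hm]
    · simp [hm.ne', hm, show c < m + 1 by omega]

theorem sum_Icc_neg_one_pow_choose_mul_choose {m n : ℕ} (c : ℕ) (h : m ≤ n) :
    ∑ k ∈ Finset.Icc (c + 1) n,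
        (-1 : ℝ) ^ (k - c + 1) * ((k - 1).choose c : ℝ) * (m.choose k : ℝ) =
      if c < m then 1 else 0 := by
  rw [← sum_range_neg_one_pow_choose_mul_choose_succ (show m ≤ c + (n - c) by omega),
    ← Finset.Ico_add_one_right_eq_Icc, Finset.sum_Ico_eq_sum_range, Nat.add_sub_add_right]
  refine Finset.sum_congr rfl fun i _ => ?_
  rw [show c + 1 + i - c + 1 = i + 2 by omega, show c + 1 + i - 1 = c + i by omega,
    show c + 1 + i = c + i + 1 by omega, pow_add]
  norm_num

/-- The binary-valued PUBO penalty for the capacity constraint `∑ y_j ≤ CMax · x`: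
`penCapa(x,y) = (1-x)·pen_0(y) + x·pen_1(y)` equals `0` when the constraint holds and
`1` otherwise, for a binary scalar `x` and a binary vector `y`. -/
theorem stmt_12 (n CMax : ℕ) (x : ℝ) (hx : x = 0 ∨ x = 1)
    (y : Fin n → ℝ) (hy : ∀ j, y j = 0 ∨ y j = 1) :
    ((∑ j, y j) ≤ (CMax : ℝ) * x →
      (1 - x) * (∑ k ∈ Finset.Icc 1 n, (-1 : ℝ) ^ (k + 1) *
          ∑ S ∈ Finset.univ.powersetCard k, ∏ j ∈ S, y j)
        + x * (∑ k ∈ Finset.Icc (CMax + 1) n,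
            (-1 : ℝ) ^ (k - CMax + 1) * ((k - 1).choose CMax : ℝ) *
              ∑ S ∈ Finset.univ.powersetCard k, ∏ j ∈ S, y j) = 0) ∧
    (¬ (∑ j, y j) ≤ (CMax : ℝ) * x →
      (1 - x) * (∑ k ∈ Finset.Icc 1 n, (-1 : ℝ) ^ (k + 1) *
          ∑ S ∈ Finset.univ.powersetCard k, ∏ j ∈ S, y j)
        + x * (∑ k ∈ Finset.Icc (CMax + 1) n,
            (-1 : ℝ) ^ (k - CMax + 1) * ((k - 1).choose CMax : ℝ) *
              ∑ S ∈ Finset.univ.powersetCard k, ∏ j ∈ S, y j) = 1) := by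
  have hm : Finset.card {j | y j = 1} ≤ n := (Finset.card_le_univ _).trans_eq (Fintype.card_fin n)
  simp only [sum_powersetCard_prod_binary y hy, sum_binary y hy]
  generalize Finset.card {j | y j = 1} = m at hm ⊢
  have hpen_zero := sum_Icc_neg_one_pow_choose_mul_choose 0 hm
  simp only [zero_add, Nat.sub_zero, Nat.choose_zero_right, Nat.cast_one, mul_one] at hpen_zero
  rw [hpen_zero, sum_Icc_neg_one_pow_choose_mul_choose CMax hm]
  rcases hx with rfl | rfl
  · simp [Nat.pos_iff_ne_zero]
  · simp
end

section
/- For all natural numbers c and α with α > c, Σ_{k=c+1}^{α} (−1)^{k−c+1} · C(k−1,c) · C(α,k) = 1. -/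
theorem alternating_sum_choose_mul_choose (c m : ℕ) :
    ∑ i ∈ Finset.range (m + 2),
      (-1 : ℤ) ^ i * ((c + i).choose c : ℤ) * ((c + 1 + m).choose (c + i) : ℤ) = 0 := by
  have key : ∀ i ∈ Finset.range (m + 2),
      (-1 : ℤ) ^ i * ((c + i).choose c : ℤ) * ((c + 1 + m).choose (c + i) : ℤ) =
        ((c + 1 + m).choose c : ℤ) * ((-1 : ℤ) ^ i * ((m + 1).choose i : ℤ)) := by
    intro i hi
    have hmul : (c + 1 + m).choose (c + i) * (c + i).choose c =
        (c + 1 + m).choose c * (m + 1).choose i := by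
      rw [Nat.choose_mul (by omega), show c + 1 + m - c = m + 1 by omega,
        Nat.add_sub_cancel_left]
    have hmul' : ((c + 1 + m).choose (c + i) : ℤ) * ((c + i).choose c : ℤ) =
        ((c + 1 + m).choose c : ℤ) * ((m + 1).choose i : ℤ) := by exact_mod_cast hmul
    linear_combination (-1 : ℤ) ^ i * hmul'
  rw [Finset.sum_congr rfl key, ← Finset.mul_sum,
    Int.alternating_sum_range_choose_of_ne m.succ_ne_zero, mul_zero]

theorem alternating_sum_choose_mul_choose_succ (c m : ℕ) :
    ∑ i ∈ Finset.range (m + 1),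
      (-1 : ℤ) ^ i * ((c + i).choose c : ℤ) * ((c + 1 + m).choose (c + 1 + i) : ℤ) = 1 := by
  induction m with
  | zero => simp
  | succ m ih =>
    have pascal : ∀ i ∈ Finset.range (m + 2),
        (-1 : ℤ) ^ i * ((c + i).choose c : ℤ) * ((c + 1 + (m + 1)).choose (c + 1 + i) : ℤ) =
          (-1 : ℤ) ^ i * ((c + i).choose c : ℤ) * ((c + 1 + m).choose (c + i) : ℤ) +
          (-1 : ℤ) ^ i * ((c + i).choose c : ℤ) * ((c + 1 + m).choose (c + 1 + i) : ℤ) := by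
      intro i _
      rw [← add_assoc (c + 1) m 1, show c + 1 + i = c + i + 1 by omega, Nat.choose_succ_succ']
      push_cast
      ring
    rw [Finset.sum_congr rfl pascal, Finset.sum_add_distrib,
      alternating_sum_choose_mul_choose, Finset.sum_range_succ, ih,
      Nat.choose_eq_zero_of_lt (show c + 1 + m < c + 1 + (m + 1) by omega)]
    simp

/-- The alternating binomial identity used in the proof of the inequality penalty:
for `α > c`, `∑_{k=c+1}^α (-1)^{k-c+1} C(k-1,c) C(α,k) = 1`. -/
theorem stmt_16 (c α : ℕ) (h : c < α) :
    ∑ k ∈ Finset.Icc (c + 1) α,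
        (-1 : ℤ) ^ (k - c + 1) * ((k - 1).choose c : ℤ) * (α.choose k : ℤ) = 1 := by
  obtain ⟨m, rfl⟩ := Nat.exists_eq_add_of_le (Nat.succ_le_of_lt h)
  rw [← Finset.Ico_add_one_right_eq_Icc, Finset.sum_Ico_eq_sum_range,
    show c.succ + m + 1 - (c + 1) = m + 1 by omega]
  refine (Finset.sum_congr rfl fun i _ => ?_).trans (alternating_sum_choose_mul_choose_succ c m)
  rw [show c + 1 + i - c + 1 = i + 2 by omega, show c + 1 + i - 1 = c + i by omega, pow_add]
  simp
end
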